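/- arXiv:2103.12361 — 3 statements merged into one kernel-verified Lean document; each statement's English description precedes it below -/
import Mathlib

section
/- Let (W,S) be a finite Coxeter system with longest element w0, let I ⊆ S, set J := {w0·s·w0 : s ∈ I} ⊆ S, and set w0^I := w0·w_{I,0}, w0^J := w0·w_{J,0}. Then the map σ0 : w ↦ w0^I·w is a bijection of W onto itself which maps ^IW bijectively onto ^JW, and for every w ∈ ^IW one has ℓ(w0^I·w) = ℓ(w0^J) − ℓ(w). -/
open CoxeterSystem

variable {B W : Type*} [Group W] {M : CoxeterMatrix B}

/-- The set of simple reflections of the Coxeter system `cs`. -/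
def CoxeterSystem.simples (cs : CoxeterSystem M W) : Set W := Set.range cs.simple

/-- `^IW`: the set of minimal-length representatives of the right cosets `W_I\W`,
where `W_I = Subgroup.closure I` is the standard parabolic subgroup generated by `I`. -/
def CoxeterSystem.minRight (cs : CoxeterSystem M W) (I : Set W) : Set W :=
  {w | ∀ u ∈ Subgroup.closure I, cs.length (u * w) = cs.length u + cs.length w}

/-- `W^I`: the set of minimal-length representatives of the left cosets `W/W_I`. -/
def CoxeterSystem.minLeft (cs : CoxeterSystem M W) (I : Set W) : Set W :=
  {w | ∀ u ∈ Subgroup.closure I, cs.length (w * u) = cs.length w + cs.length u}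

/-- The (strong) Bruhat order on a Coxeter group: the reflexive-transitive closure of the
relation `a → a * t` where `t` is a reflection and multiplication increases length. -/
def CoxeterSystem.bruhatLE (cs : CoxeterSystem M W) : W → W → Prop :=
  Relation.ReflTransGen (fun a b => cs.length a < cs.length b ∧ ∃ t, cs.IsReflection t ∧ b = a * t)

open Classical in
/-- The generator action used to prove strong exchange. -/
noncomputable def sgF (cs : CoxeterSystem M W) (i : B) : Function.End (W × ZMod 2) :=
  fun p => (cs.simple i * p.1 * cs.simple i, p.2 + if p.1 = cs.simple i then 1 else 0)

open Classical in
theorem sgF_pow (cs : CoxeterSystem M W) (i j : B) (m : ℕ) (t : W) (z : ZMod 2) :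
    ((sgF cs i * sgF cs j) ^ m) (t, z) =
      ((cs.simple i * cs.simple j) ^ m * t * ((cs.simple i * cs.simple j) ^ m)⁻¹,
       z + ∑ l ∈ Finset.range (2 * m),
        if t = cs.simple j * (cs.simple i * cs.simple j) ^ l then 1 else 0) := by
  induction m with
  | zero => simp; rfl
  | succ m ih =>
    rw [pow_succ']
    change sgF cs i (sgF cs j (((sgF cs i * sgF cs j) ^ m) (t, z))) = _
    rw [ih]
    set p := cs.simple i * cs.simple j with hp
    have hsi := cs.simple_mul_simple_self i
    have hsj := cs.simple_mul_simple_self j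
    have hpinv : p⁻¹ = cs.simple j * cs.simple i := by simp [hp]
    have hk : ∀ k : ℕ, cs.simple j * p ^ k * cs.simple j = (p ^ k)⁻¹ := by
      intro k
      have h1 : cs.simple j * p * (cs.simple j)⁻¹ = p⁻¹ := by
        rw [hpinv, hp]; simp [mul_assoc]
      have h2 : (cs.simple j * p * (cs.simple j)⁻¹) ^ k = (p⁻¹) ^ k := by rw [h1]
      rw [conj_pow, inv_pow, cs.inv_simple] at h2
      exact h2
    have hk' : ∀ k : ℕ, (p ^ k)⁻¹ * cs.simple j = cs.simple j * p ^ k := by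
      intro k
      rw [← hk k]; simp [mul_assoc]
    have e1 : (p ^ m * t * (p ^ m)⁻¹ = cs.simple j) ↔ t = cs.simple j * p ^ (2 * m) := by
      rw [two_mul, pow_add, ← mul_assoc, ← hk' m]
      constructor
      · intro h; rw [← h]; group
      · intro h; rw [h]; group
    have e2 : (cs.simple j * (p ^ m * t * (p ^ m)⁻¹) * cs.simple j = cs.simple i) ↔
        t = cs.simple j * p ^ (2 * m + 1) := by
      have : cs.simple j * p ^ (2 * m + 1) = (p ^ m)⁻¹ * (cs.simple j * cs.simple i * cs.simple j) * p ^ m := by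
        rw [show 2 * m + 1 = m + (1 + m) by ring, pow_add, pow_add, ← mul_assoc, ← hk' m, pow_one]
        simp [hp, mul_assoc]
      rw [this]
      constructor
      · intro h; rw [← h]; simp [mul_assoc]
      · intro h; rw [h]; simp [mul_assoc]
    simp only [sgF]
    rw [show 2 * (m + 1) = 2 * m + 1 + 1 by ring, Finset.sum_range_succ, Finset.sum_range_succ]
    ext1
    · simp [pow_succ', hp, mul_assoc]
    · simp only [e1, e2]; ring

theorem sgF_liftable (cs : CoxeterSystem M W) : M.IsLiftable (sgF cs) := by
  classical
  intro i j
  funext ⟨t, z⟩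
  rw [sgF_pow]
  change _ = (t, z)
  rw [cs.simple_mul_simple_pow i j, two_mul, Finset.sum_range_add]
  simp only [pow_add, cs.simple_mul_simple_pow i j, one_mul]
  rw [← two_mul]
  simp [show (2 : ZMod 2) = 0 from rfl]

/-- The lifted action. -/
noncomputable def sgPhi (cs : CoxeterSystem M W) : W →* Function.End (W × ZMod 2) :=
  cs.lift ⟨sgF cs, sgF_liftable cs⟩

theorem sgPhi_simple (cs : CoxeterSystem M W) (i : B) : sgPhi cs (cs.simple i) = sgF cs i :=
  cs.lift_apply_simple _ i

open Classical in
theorem sgPhi_word (cs : CoxeterSystem M W) (ω : List B) (t : W) (z : ZMod 2) :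
    sgPhi cs (cs.wordProd ω) (t, z) = (cs.wordProd ω * t * (cs.wordProd ω)⁻¹,
      z + ((cs.rightInvSeq ω).count t : ℕ)) := by
  induction ω with
  | nil => simp; rfl
  | cons i ω ih =>
    rw [cs.wordProd_cons, map_mul]
    change sgPhi cs (cs.simple i) (sgPhi cs (cs.wordProd ω) (t, z)) = _
    rw [ih, sgPhi_simple]
    have : (cs.wordProd ω * t * (cs.wordProd ω)⁻¹ = cs.simple i) ↔
        (cs.wordProd ω)⁻¹ * cs.simple i * cs.wordProd ω = t := by
      constructor
      · intro h; rw [← h]; group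
      · intro h; rw [← h]; group
    simp only [sgF, this, CoxeterSystem.rightInvSeq, List.count_cons]
    ext1
    · simp [mul_assoc]
    · simp [add_assoc]

/-- Parity cocycle. -/
noncomputable def sgN (cs : CoxeterSystem M W) (w t : W) : ZMod 2 := (sgPhi cs w (t, 0)).2

theorem sgPhi_eq (cs : CoxeterSystem M W) (w t : W) (z : ZMod 2) :
    sgPhi cs w (t, z) = (w * t * w⁻¹, z + sgN cs w t) := by
  classical
  obtain ⟨ω, -, rfl⟩ := cs.exists_isReduced w
  rw [sgN, sgPhi_word, sgPhi_word]; simp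

theorem sgN_mul (cs : CoxeterSystem M W) (u v t : W) :
    sgN cs (u * v) t = sgN cs v t + sgN cs u (v * t * v⁻¹) := by
  have : sgPhi cs (u * v) (t, 0) = sgPhi cs u (sgPhi cs v (t, 0)) := by rw [map_mul]; rfl
  rw [sgPhi_eq, sgPhi_eq, sgPhi_eq] at this
  simpa using congrArg Prod.snd this

theorem sgN_one (cs : CoxeterSystem M W) (t : W) : sgN cs 1 t = 0 := by
  simp [sgN]; rfl

theorem sgN_simple (cs : CoxeterSystem M W) (i : B) : sgN cs (cs.simple i) (cs.simple i) = 1 := by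
  simp [sgN, sgPhi_simple, sgF]

theorem sgN_refl (cs : CoxeterSystem M W) {t : W} (ht : cs.IsReflection t) : sgN cs t t = 1 := by
  obtain ⟨w, i, rfl⟩ := ht
  have h0 := sgN_mul cs w w⁻¹ (w * cs.simple i * w⁻¹)
  rw [mul_inv_cancel, sgN_one] at h0
  have e : w⁻¹ * (w * cs.simple i * w⁻¹) * w⁻¹⁻¹ = cs.simple i := by group
  rw [e] at h0
  rw [sgN_mul, e, sgN_mul, sgN_simple]
  simp only [cs.simple_mul_simple_self, one_mul, cs.inv_simple]
  linear_combination -h0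

theorem sgN_lt (cs : CoxeterSystem M W) {w t : W} (h : sgN cs w t ≠ 0) :
    cs.length (w * t) < cs.length w := by
  classical
  obtain ⟨ω, hω, rfl⟩ := cs.exists_isReduced w
  apply (cs.isRightInversion_of_mem_rightInvSeq hω _).2
  by_contra hn
  apply h
  rw [sgN, sgPhi_word, List.count_eq_zero_of_not_mem hn]; simp

theorem sgN_ne (cs : CoxeterSystem M W) {w t : W} (ht : cs.IsReflection t)
    (h : cs.length (w * t) < cs.length w) : sgN cs w t ≠ 0 := by
  intro h0
  have := sgN_mul cs w t t
  rw [sgN_refl cs ht, mul_inv_cancel_right, h0] at this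
  have h2 := sgN_lt cs (w := w * t) (t := t) (by rw [this]; decide)
  rw [mul_assoc, ht.mul_self, mul_one] at h2
  omega

/-- Exchange, right version. -/
theorem sg_exch (cs : CoxeterSystem M W) {u v t : W} (ht : cs.IsReflection t)
    (h : cs.length (u * v * t) < cs.length (u * v)) :
    cs.length (v * t) < cs.length v ∨ cs.length (u * (v * t * v⁻¹)) < cs.length u := by
  have := sgN_ne cs ht h
  rw [sgN_mul] at this
  by_cases h1 : sgN cs v t = 0
  · right; apply sgN_lt; rwa [h1, zero_add] at this
  · left; exact sgN_lt cs h1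

/-- Right descents of elements of a parabolic subgroup lie in it. -/
theorem sg_mem (cs : CoxeterSystem M W) (I : Set W) (hI : I ⊆ cs.simples) (u : W)
    (hu : u ∈ Subgroup.closure I) : ∀ t, cs.IsReflection t → cs.length (u * t) < cs.length u →
    t ∈ Subgroup.closure I := by
  have key : ∀ s ∈ I, ∀ v, v ∈ Subgroup.closure I →
      (∀ t, cs.IsReflection t → cs.length (v * t) < cs.length v → t ∈ Subgroup.closure I) →
      ∀ t, cs.IsReflection t → cs.length (v * s * t) < cs.length (v * s) →
        t ∈ Subgroup.closure I := by
    intro s hs v hv ih t ht h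
    have hsI := Subgroup.subset_closure (k := I) hs
    obtain ⟨i, rfl⟩ := hI hs
    rcases sg_exch cs ht h with h | h
    · rw [cs.length_simple, Nat.lt_one_iff, cs.length_eq_zero_iff] at h
      rw [← inv_eq_of_mul_eq_one_right h]
      exact inv_mem hsI
    · have := ih _ (ht.conj _) h
      have h3 := mul_mem (mul_mem (inv_mem hsI) this) hsI
      simpa [mul_assoc] using h3
  induction hu using Subgroup.closure_induction_right with
  | one => intro t _ h; simp at h
  | mul_right x hx y hy ih => exact key y hy x hx ih
  | mul_inv_cancel x hx y hy ih =>
    have : y⁻¹ = y := by obtain ⟨i, rfl⟩ := hI hy; simp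
    rw [this]; exact key y hy x hx ih

theorem sg_long (cs : CoxeterSystem M W) (I : Set W) (hI : I ⊆ cs.simples) (x : W)
    (hx : x ∈ Subgroup.closure I)
    (hmax : ∀ u ∈ Subgroup.closure I, cs.length u ≤ cs.length x) :
    ∀ n, ∀ v ∈ Subgroup.closure I, cs.length v = n →
      cs.length (x * v) + cs.length v = cs.length x := by
  intro n
  induction n with
  | zero =>
    intro v _ h
    rw [cs.length_eq_zero_iff] at h
    simp [h]
  | succ n ih =>
    intro v' hv' hl
    have hne : v' ≠ 1 := by rintro rfl; simp at hl
    obtain ⟨i, hi⟩ := cs.exists_rightDescent_of_ne_one hne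
    have hsI := sg_mem cs I hI v' hv' _ (cs.isReflection_simple i) hi
    have hi' := cs.isRightDescent_iff.1 hi
    obtain ⟨v, rfl⟩ : ∃ v, v' = v * cs.simple i := ⟨v' * cs.simple i, by simp⟩
    rw [cs.simple_mul_simple_cancel_right] at hi'
    have hv : v ∈ Subgroup.closure I := by
      simpa using mul_mem hv' hsI
    have h1 := ih v hv (by omega)
    have h2 : cs.length (x * v * cs.simple i) < cs.length (x * v) := by
      have hr := (cs.isReflection_simple i).conj v
      have hlt : cs.length (x * (v * cs.simple i * v⁻¹)) < cs.length x := by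
        refine lt_of_le_of_ne (hmax _ ?_) (hr.length_mul_left_ne x)
        exact mul_mem hx (mul_mem hv' (inv_mem hv))
      have e : x * v * v⁻¹ = x := by group
      have := sg_exch cs (u := x * v) (v := v⁻¹) hr (by rw [e]; exact hlt)
      rcases this with h | h
      · rw [show v⁻¹ * (v * cs.simple i * v⁻¹) = (v * cs.simple i)⁻¹ by simp [mul_assoc],
          cs.length_inv, cs.length_inv] at h
        omega
      · simpa [mul_assoc] using h
    have h3 := cs.isRightDescent_iff.1 (show cs.IsRightDescent (x * v) i from h2)
    rw [← mul_assoc]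
    omega

/-- The map `σ0 : w ↦ w0^I · w`, where `w0^I = w0 · w_{I,0}`, is a bijection of `W` mapping
`^IW` bijectively onto `^JW`, with `ℓ(w0^I · w) = ℓ(w0^J) − ℓ(w)` for every `w ∈ ^IW`. -/
theorem sigma0_bijection_length [Finite W] (cs : CoxeterSystem M W)
    (I : Set W) (hI : I ⊆ cs.simples)
    (w0 : W) (hw0 : ∀ w : W, cs.length w ≤ cs.length w0)
    (J : Set W) (hJ : J = (fun s => w0 * s * w0) '' I)
    (wI0 : W) (hwI0mem : wI0 ∈ Subgroup.closure I)
    (hwI0max : ∀ u ∈ Subgroup.closure I, cs.length u ≤ cs.length wI0)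
    (wJ0 : W) (hwJ0mem : wJ0 ∈ Subgroup.closure J)
    (hwJ0max : ∀ u ∈ Subgroup.closure J, cs.length u ≤ cs.length wJ0) :
    Function.Bijective (fun w : W => (w0 * wI0) * w) ∧
    Set.BijOn (fun w : W => (w0 * wI0) * w) (cs.minRight I) (cs.minRight J) ∧
    (∀ w ∈ cs.minRight I,
      cs.length ((w0 * wI0) * w) = cs.length (w0 * wJ0) - cs.length w) := by
  have L0 : ∀ v, cs.length (w0 * v) + cs.length v = cs.length w0 := by
    have ht : Subgroup.closure cs.simples = ⊤ := cs.subgroup_closure_range_simple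
    intro v
    exact sg_long cs cs.simples subset_rfl w0 (by rw [ht]; trivial) (fun u _ => hw0 u) _ v
      (by rw [ht]; trivial) rfl
  have LI : ∀ v ∈ Subgroup.closure I, cs.length (wI0 * v) + cs.length v = cs.length wI0 :=
    fun v hv => sg_long cs I hI wI0 hwI0mem hwI0max _ v hv rfl
  have q0 : w0 * w0 = 1 := by
    have := L0 w0
    exact cs.length_eq_zero_iff.1 (by omega)
  have qI : wI0 * wI0 = 1 := by
    have := LI wI0 hwI0mem
    exact cs.length_eq_zero_iff.1 (by omega)
  have i0 : w0⁻¹ = w0 := inv_eq_of_mul_eq_one_right q0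
  have iI : wI0⁻¹ = wI0 := inv_eq_of_mul_eq_one_right qI
  have c0 : ∀ x, w0 * (w0 * x) = x := fun x => by rw [← mul_assoc, q0, one_mul]
  have cI : ∀ x, wI0 * (wI0 * x) = x := fun x => by rw [← mul_assoc, qI, one_mul]
  have R0 : ∀ v, cs.length (v * w0) + cs.length v = cs.length w0 := by
    intro v
    have := L0 v⁻¹
    rwa [← cs.length_inv, mul_inv_rev, inv_inv, i0, cs.length_inv v] at this
  have RI : ∀ v ∈ Subgroup.closure I, cs.length (v * wI0) + cs.length v = cs.length wI0 := by
    intro v hv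
    have := LI v⁻¹ (inv_mem hv)
    rwa [← cs.length_inv, mul_inv_rev, inv_inv, iI, cs.length_inv v] at this
  have C0 : ∀ v, cs.length (w0 * v * w0) = cs.length v := by
    intro v
    have := L0 v
    have := R0 (w0 * v)
    omega
  have HJ : ∀ v, v ∈ Subgroup.closure J ↔ w0 * v * w0 ∈ Subgroup.closure I := by
    have e : Subgroup.closure J = (Subgroup.closure I).map (MulAut.conj w0).toMonoidHom := by
      rw [MonoidHom.map_closure, hJ]
      congr 1
      ext x
      simp [i0]
    intro v
    rw [e, Subgroup.mem_map]
    constructor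
    · rintro ⟨y, hy, rfl⟩
      simpa [i0, mul_assoc, c0, q0] using hy
    · intro h
      exact ⟨_, h, by simp [i0, mul_assoc, c0, q0]⟩
  have HJ' : ∀ v, v ∈ Subgroup.closure I → w0 * v * w0 ∈ Subgroup.closure J := by
    intro v hv
    rw [HJ]
    simpa [mul_assoc, c0, q0] using hv
  have lJ : cs.length wJ0 = cs.length wI0 := by
    apply le_antisymm
    · rw [← C0 wJ0]; exact hwI0max _ ((HJ _).1 hwJ0mem)
    · rw [← C0 wI0]; exact hwJ0max _ (HJ' _ hwI0mem)
  have main : ∀ w ∈ cs.minRight I, ∀ v ∈ Subgroup.closure I,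
      cs.length (w0 * (v * wI0 * w)) + cs.length wI0 + cs.length w = cs.length w0 + cs.length v := by
    intro w hw v hv
    have h1 := hw (v * wI0) (mul_mem hv hwI0mem)
    have h2 := L0 (v * wI0 * w)
    have h3 := RI v hv
    omega
  refine ⟨(Group.mulLeft_bijective _), ⟨?_, (mul_right_injective _).injOn, ?_⟩, ?_⟩
  · intro w hw u hu
    have h1 := main w hw _ ((HJ u).1 hu)
    have h2 := main w hw 1 (one_mem _)
    rw [C0, show w0 * (w0 * u * w0 * wI0 * w) = u * (w0 * wI0 * w) by simp [mul_assoc, c0]] at h1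
    simp only [one_mul, cs.length_one, ← mul_assoc] at h2
    dsimp only
    simp only [← mul_assoc] at h1 ⊢
    omega
  · intro x hx
    refine ⟨wI0 * (w0 * x), ?_, by simp [mul_assoc, c0, cI]⟩
    have m2 : ∀ v ∈ Subgroup.closure I, cs.length (v * (wI0 * (w0 * x))) + cs.length wI0
        + cs.length x = cs.length w0 + cs.length v := by
      intro v hv
      have h1 := hx _ (HJ' _ (mul_mem hv hwI0mem))
      have h2 := L0 (w0 * (v * wI0) * w0 * x)
      have h3 := RI v hv
      rw [C0] at h1
      rw [show w0 * (w0 * (v * wI0) * w0 * x) = v * (wI0 * (w0 * x)) by simp [mul_assoc, c0]] at h2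
      omega
    intro v hv
    have h1 := m2 v hv
    have h2 := m2 1 (one_mem _)
    rw [one_mul, cs.length_one] at h2
    omega
  · intro w hw
    have h2 := main w hw 1 (one_mem _)
    have h3 := L0 wJ0
    simp only [one_mul, cs.length_one, ← mul_assoc] at h2
    omega
end

section
/- Let (W,S) be a finite Coxeter system with longest element w0, let I ⊆ S, set J := {w0·s·w0 : s ∈ I} ⊆ S and w0^I := w0·w_{I,0}. Let φ : W → W be a group automorphism with φ(S) = S, and set z := φ(w0^I). Define relations: for w', w ∈ ^IW, w' ⪯_I w iff there exists u ∈ W_I with u·w'·z·φ(u)⁻¹·z⁻¹ ≤ w in the Bruhat order; for w', w ∈ ^JW, w' ⪯_J w iff there exists u ∈ W_J with u·w'·φ(u)⁻¹ ≤ w in the Bruhat order. Then the bijection σ0 : ^IW → ^JW, w ↦ w0^I·w, reverses these relations: for all w, w' ∈ ^IW, if w' ⪯_I w then w0^I·w ⪯_J w0^I·w'. -/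
open CoxeterSystem

variable {B W : Type*} [Group W] {M : CoxeterMatrix B}

namespace CoxAux

open Classical in
/-- generator of the reflection representation on signed elements -/
noncomputable def gen (cs : CoxeterSystem M W) (i : B) : Equiv.Perm (W × ZMod 2) where
  toFun p := (cs.simple i * p.1 * cs.simple i, p.2 + if p.1 = cs.simple i then 1 else 0)
  invFun p := (cs.simple i * p.1 * cs.simple i, p.2 + if p.1 = cs.simple i then 1 else 0)
  left_inv p := by
    have h : (cs.simple i * p.1 * cs.simple i = cs.simple i) ↔ p.1 = cs.simple i := by
      constructor
      · intro h
        have := congrArg (fun x => cs.simple i * x * cs.simple i) h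
        simpa [mul_assoc] using this
      · intro h; simp [h]
    ext
    · simp [mul_assoc]
    · simp only [h, add_assoc, CharTwo.add_self_eq_zero, add_zero]
  right_inv p := by
    have h : (cs.simple i * p.1 * cs.simple i = cs.simple i) ↔ p.1 = cs.simple i := by
      constructor
      · intro h
        have := congrArg (fun x => cs.simple i * x * cs.simple i) h
        simpa [mul_assoc] using this
      · intro h; simp [h]
    ext
    · simp [mul_assoc]
    · simp only [h, add_assoc, CharTwo.add_self_eq_zero, add_zero]

lemma dpow (cs : CoxeterSystem M W) (i j : B) (n : ℕ) :
    (cs.simple j * cs.simple i) ^ n * cs.simple j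
      = cs.simple j * (cs.simple i * cs.simple j) ^ n := by
  induction n with
  | zero => simp
  | succ n ih => rw [pow_succ', mul_assoc, ih, pow_succ']; simp [mul_assoc]

lemma ginv (cs : CoxeterSystem M W) (i j : B) (n : ℕ) :
    ((cs.simple i * cs.simple j) ^ n)⁻¹ = (cs.simple j * cs.simple i) ^ n := by
  rw [← inv_pow]; simp

open Classical in
lemma gen_pow (cs : CoxeterSystem M W) (i j : B) (n : ℕ) (p : W × ZMod 2) :
    ((gen cs i * gen cs j) ^ n) p =
      ((cs.simple i * cs.simple j) ^ n * p.1 * (cs.simple j * cs.simple i) ^ n,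
        p.2 + ∑ k ∈ Finset.range (2 * n),
          if p.1 = (cs.simple j * cs.simple i) ^ k * cs.simple j then 1 else 0) := by
  induction n with
  | zero => simp
  | succ n ih =>
    rw [pow_succ', Equiv.Perm.mul_apply, ih, Equiv.Perm.mul_apply]
    have h1 : ((cs.simple i * cs.simple j) ^ n * p.1 * (cs.simple j * cs.simple i) ^ n
        = cs.simple j) ↔ p.1 = (cs.simple j * cs.simple i) ^ (2 * n) * cs.simple j := by
      rw [two_mul, pow_add, mul_assoc _ _ (cs.simple j), dpow, ← ginv cs i j]
      generalize (cs.simple i * cs.simple j) ^ n = G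
      constructor
      · intro h; rw [← h]; group
      · intro h; rw [h]; group
    have h2 : (cs.simple j * ((cs.simple i * cs.simple j) ^ n * p.1 *
        (cs.simple j * cs.simple i) ^ n) * cs.simple j
        = cs.simple i) ↔ p.1 = (cs.simple j * cs.simple i) ^ (2 * n + 1) * cs.simple j := by
      have e : (cs.simple j * cs.simple i) ^ (2 * n + 1) * cs.simple j
          = (cs.simple j * cs.simple i) ^ n * (cs.simple j * cs.simple i * cs.simple j) *
            (cs.simple i * cs.simple j) ^ n := by
        rw [show 2 * n + 1 = n + 1 + n by ring, pow_add, mul_assoc, dpow, pow_succ]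
        simp [mul_assoc]
      rw [e, ← ginv cs i j]
      generalize (cs.simple i * cs.simple j) ^ n = G
      constructor
      · intro h
        rw [← h]; simp only [mul_assoc, simple_mul_simple_cancel_left, simple_mul_simple_self]
        simp [mul_assoc]
      · intro h; rw [h]
        simp [mul_assoc]
    ext
    · simp [gen, pow_succ', mul_assoc]
      rw [← mul_assoc _ (cs.simple j), mul_assoc _ (cs.simple j), ← pow_succ, pow_succ', mul_assoc]
    · simp only [gen, Equiv.coe_fn_mk, h1, h2]
      rw [show 2 * (n + 1) = 2 * n + 1 + 1 by ring, Finset.sum_range_succ, Finset.sum_range_succ]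
      ring

lemma gen_liftable (cs : CoxeterSystem M W) : M.IsLiftable (gen cs) := by
  classical
  intro i j
  ext1 p
  rw [gen_pow]
  have hm : (cs.simple i * cs.simple j) ^ M i j = 1 := cs.simple_mul_simple_pow i j
  have hm' : (cs.simple j * cs.simple i) ^ M i j = 1 := cs.simple_mul_simple_pow' i j
  rw [two_mul, Finset.sum_range_add]
  simp only [pow_add, hm, hm', one_mul, mul_one, CharTwo.add_self_eq_zero, add_zero]
  simp

noncomputable def rep (cs : CoxeterSystem M W) : W →* Equiv.Perm (W × ZMod 2) :=
  cs.lift ⟨gen cs, gen_liftable cs⟩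

/-- the inversion cocycle -/
noncomputable def eta (cs : CoxeterSystem M W) (w t : W) : ZMod 2 := (rep cs w (t, 0)).2

lemma rep_simple (cs : CoxeterSystem M W) (i : B) : rep cs (cs.simple i) = gen cs i :=
  cs.lift_apply_simple _ _

open Classical in
lemma rep_word (cs : CoxeterSystem M W) (ω : List B) (t : W) (e : ZMod 2) :
    rep cs (cs.wordProd ω) (t, e) =
      (cs.wordProd ω * t * (cs.wordProd ω)⁻¹, e + ((cs.rightInvSeq ω).count t : ZMod 2)) := by
  induction ω with
  | nil => simp
  | cons i ω ih =>
    rw [cs.wordProd_cons, map_mul, Equiv.Perm.mul_apply, ih, rep_simple]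
    have h : (cs.wordProd ω * t * (cs.wordProd ω)⁻¹ = cs.simple i) ↔
        ((cs.wordProd ω)⁻¹ * cs.simple i * cs.wordProd ω = t) := by
      constructor
      · intro h; rw [← h]; group
      · intro h; rw [← h]; group
    ext
    · simp [gen, mul_assoc]
    · simp only [gen, Equiv.coe_fn_mk, h, rightInvSeq, List.count_cons, beq_iff_eq]
      push_cast
      ring

lemma rep_apply (cs : CoxeterSystem M W) (w t : W) (e : ZMod 2) :
    rep cs w (t, e) = (w * t * w⁻¹, e + eta cs w t) := by
  obtain ⟨ω, -, rfl⟩ := cs.exists_isReduced w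
  rw [eta, rep_word, rep_word]; simp

lemma eta_mul (cs : CoxeterSystem M W) (a b t : W) :
    eta cs (a * b) t = eta cs b t + eta cs a (b * t * b⁻¹) := by
  have := rep_apply cs (a * b) t 0
  rw [map_mul, Equiv.Perm.mul_apply, rep_apply, rep_apply] at this
  simpa using (congrArg Prod.snd this).symm

lemma eta_one (cs : CoxeterSystem M W) (t : W) : eta cs 1 t = 0 := by simp [eta]

lemma eta_simple (cs : CoxeterSystem M W) (i : B) : eta cs (cs.simple i) (cs.simple i) = 1 := by
  simp [eta, rep_simple, gen]

lemma eta_simple_ne (cs : CoxeterSystem M W) (i : B) (t : W) (h : t ≠ cs.simple i) :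
    eta cs (cs.simple i) t = 0 := by
  simp [eta, rep_simple, gen, h]

lemma eta_self (cs : CoxeterSystem M W) (t : W) (ht : cs.IsReflection t) : eta cs t t = 1 := by
  obtain ⟨w, i, rfl⟩ := ht
  have h0 := eta_mul cs w⁻¹ w (cs.simple i)
  rw [inv_mul_cancel, eta_one] at h0
  rw [eta_mul cs (w * cs.simple i), eta_mul cs w]
  have e : w⁻¹ * (w * cs.simple i * w⁻¹) * w⁻¹⁻¹ = cs.simple i := by group
  rw [e, eta_simple]
  have e2 : cs.simple i * cs.simple i * (cs.simple i)⁻¹ = cs.simple i := by group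
  rw [e2]
  linear_combination -h0

lemma mem_of_eta (cs : CoxeterSystem M W) (ω : List B) (t : W)
    (h : eta cs (cs.wordProd ω) t = 1) : t ∈ cs.rightInvSeq ω := by
  classical
  rw [eta, rep_word] at h
  by_contra hn
  simp [List.count_eq_zero_of_not_mem hn] at h

lemma z2 (x : ZMod 2) : x = 0 ∨ x = 1 := by revert x; decide

lemma eta_iff (cs : CoxeterSystem M W) (w t : W) (ht : cs.IsReflection t) :
    eta cs w t = 1 ↔ cs.length (w * t) < cs.length w := by
  have key : ∀ w, eta cs w t = 1 → cs.length (w * t) < cs.length w := by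
    intro w h
    obtain ⟨ω, hω, rfl⟩ := cs.exists_isReduced w
    exact (cs.isRightInversion_of_mem_rightInvSeq hω (mem_of_eta cs ω t h)).2
  refine ⟨key w, fun h => ?_⟩
  rcases z2 (eta cs w t) with h0 | h0
  · have := key (w * t) (by
      rw [eta_mul, eta_self cs t ht, mul_inv_cancel_right, h0, add_zero])
    rw [mul_assoc, ht.mul_self, mul_one] at this
    omega
  · exact h0

lemma eta_zero_iff (cs : CoxeterSystem M W) (w t : W) (ht : cs.IsReflection t) :
    eta cs w t = 0 ↔ cs.length w < cs.length (w * t) := by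
  have h1 := eta_iff cs w t ht
  have h2 := ht.length_mul_left_ne w
  rcases z2 (eta cs w t) with h0 | h0
  · have : ¬ cs.length (w * t) < cs.length w := by rw [← h1, h0]; decide
    simp only [h0, true_iff]; omega
  · have := h1.1 h0
    simp only [h0, one_ne_zero, false_iff]; omega

/-- lengths of `x*y` against `t*x*y`... -/
lemma F1 (cs : CoxeterSystem M W) (x t : W) (i : B) (ht : cs.IsReflection t)
    (hne : t ≠ cs.simple i) (h : cs.length x < cs.length (x * t)) :
    cs.length (x * cs.simple i) < cs.length (x * t * cs.simple i) := by
  have hr := ht.conj (cs.simple i)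
  have h0 := (eta_zero_iff cs x t ht).2 h
  have := (eta_zero_iff cs (x * cs.simple i) _ hr).1 (by
    rw [eta_mul, eta_simple_ne, zero_add]
    · simpa [mul_assoc] using h0
    · intro h
      apply hne
      have := congrArg (fun x => cs.simple i * x * cs.simple i) h
      simpa [mul_assoc] using this)
  simpa [mul_assoc] using this

lemma ble_refl (cs : CoxeterSystem M W) (x : W) : cs.bruhatLE x x := Relation.ReflTransGen.refl

lemma ble_trans (cs : CoxeterSystem M W) {x y z : W} (h : cs.bruhatLE x y)
    (h' : cs.bruhatLE y z) : cs.bruhatLE x z := Relation.ReflTransGen.trans h h'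

lemma ble_step (cs : CoxeterSystem M W) {x y t : W} (ht : cs.IsReflection t) (e : y = x * t)
    (h : cs.length x < cs.length y) : cs.bruhatLE x y :=
  Relation.ReflTransGen.single ⟨h, t, ht, e⟩

lemma ble_simple (cs : CoxeterSystem M W) {x : W} {i : B}
    (h : cs.length x < cs.length (x * cs.simple i)) : cs.bruhatLE x (x * cs.simple i) :=
  ble_step cs (cs.isReflection_simple i) rfl h

lemma ble_len (cs : CoxeterSystem M W) {x y : W} (h : cs.bruhatLE x y) :
    x = y ∨ cs.length x < cs.length y := by
  unfold CoxeterSystem.bruhatLE at h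
  induction h with
  | refl => left; rfl
  | tail _ h ih =>
    right
    rcases ih with rfl | ih
    · exact h.1
    · exact ih.trans h.1

lemma ble_one (cs : CoxeterSystem M W) {x : W} (h : cs.bruhatLE x 1) : x = 1 := by
  rcases ble_len cs h with h | h
  · exact h
  · simp at h

lemma ble_inv (cs : CoxeterSystem M W) {x y : W} (h : cs.bruhatLE x y) :
    cs.bruhatLE x⁻¹ y⁻¹ := by
  unfold CoxeterSystem.bruhatLE at h
  induction h with
  | refl => exact ble_refl _ _
  | @tail b c _ h ih =>
    obtain ⟨hl, t, ht, rfl⟩ := h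
    refine ble_trans cs ih (ble_step cs (ht.conj b) ?_ ?_)
    · rw [mul_inv_rev, ht.inv]; group
    · simpa only [cs.length_inv] using hl

/-- lifting -/
lemma lift (cs : CoxeterSystem M W) {x y : W} (i : B) (h : cs.bruhatLE x y) :
    cs.bruhatLE (x * cs.simple i) (y * cs.simple i) ∨
      (cs.bruhatLE x (y * cs.simple i) ∧ cs.bruhatLE (x * cs.simple i) y) := by
  unfold CoxeterSystem.bruhatLE at h
  induction h with
  | refl => left; exact ble_refl _ _
  | @tail y y' hxy h ih =>
    obtain ⟨hl, t, ht, rfl⟩ := h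
    have st : cs.bruhatLE y (y * t) := ble_step cs ht rfl hl
    by_cases e : t = cs.simple i
    · subst e
      have hxy' : cs.bruhatLE x y := hxy
      right
      simp only [mul_assoc, cs.simple_mul_simple_self, mul_one]
      refine ⟨hxy', ?_⟩
      rcases ih with ih | ih
      · exact ih
      · exact ble_trans cs ih.2 st
    · have s2 : cs.bruhatLE (y * cs.simple i) (y * t * cs.simple i) := by
        refine ble_step cs (ht.conj (cs.simple i)) ?_ (F1 cs y t i ht e hl)
        simp [mul_assoc]
      rcases ih with ih | ih
      · left; exact ble_trans cs ih s2
      · right; exact ⟨ble_trans cs ih.1 s2, ble_trans cs ih.2 st⟩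

lemma lift_a (cs : CoxeterSystem M W) {x y : W} (i : B) (h : cs.bruhatLE x y)
    (hy : cs.length y < cs.length (y * cs.simple i)) :
    cs.bruhatLE (x * cs.simple i) (y * cs.simple i) := by
  rcases lift cs i h with h | h
  · exact h
  · exact ble_trans cs h.2 (ble_simple cs hy)

lemma lift_b (cs : CoxeterSystem M W) {x y : W} (i : B) (h : cs.bruhatLE x y)
    (hx : cs.length (x * cs.simple i) < cs.length x) :
    cs.bruhatLE (x * cs.simple i) (y * cs.simple i) := by
  rcases lift cs i h with h | h
  · exact h
  · refine ble_trans cs ?_ h.1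
    have := ble_simple cs (x := x * cs.simple i) (i := i) (by simpa [mul_assoc] using hx)
    simpa [mul_assoc] using this

lemma liftL (cs : CoxeterSystem M W) {x y : W} (i : B) (h : cs.bruhatLE x y) :
    cs.bruhatLE (cs.simple i * x) (cs.simple i * y) ∨
      (cs.bruhatLE x (cs.simple i * y) ∧ cs.bruhatLE (cs.simple i * x) y) := by
  rcases lift cs i (ble_inv cs h) with h | ⟨h, h'⟩
  · left; simpa using ble_inv cs h
  · right; exact ⟨by simpa using ble_inv cs h, by simpa using ble_inv cs h'⟩

lemma ble_simpleL (cs : CoxeterSystem M W) {x : W} {i : B}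
    (h : cs.length x < cs.length (cs.simple i * x)) : cs.bruhatLE x (cs.simple i * x) := by
  have := ble_simple cs (x := x⁻¹) (i := i) (by
    rw [← cs.length_inv (x⁻¹ * _), cs.length_inv x]; simpa using h)
  simpa using ble_inv cs this

lemma liftL_a (cs : CoxeterSystem M W) {x y : W} (i : B) (h : cs.bruhatLE x y)
    (hy : cs.length y < cs.length (cs.simple i * y)) :
    cs.bruhatLE (cs.simple i * x) (cs.simple i * y) := by
  rcases liftL cs i h with h | h
  · exact h
  · exact ble_trans cs h.2 (ble_simpleL cs hy)

/-- reduced words in parabolic subgroups -/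
lemma exists_red (cs : CoxeterSystem M W) (J : Set W) (hJ : J ⊆ cs.simples) (u : W)
    (hu : u ∈ Subgroup.closure J) :
    ∃ ω : List B, cs.IsReduced ω ∧ (∀ i ∈ ω, cs.simple i ∈ J) ∧ cs.wordProd ω = u := by
  have step : ∀ x ∈ J, ∀ y, (∃ ω : List B, cs.IsReduced ω ∧ (∀ i ∈ ω, cs.simple i ∈ J) ∧
      cs.wordProd ω = y) → ∃ ω : List B, cs.IsReduced ω ∧ (∀ i ∈ ω, cs.simple i ∈ J) ∧
      cs.wordProd ω = x * y := by
    rintro x hx y ⟨ω, hω, hωJ, rfl⟩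
    obtain ⟨i, rfl⟩ := hJ hx
    rcases cs.length_simple_mul (cs.wordProd ω) i with h | h
    · refine ⟨i :: ω, ?_, ?_, cs.wordProd_cons i ω⟩
      · rw [CoxeterSystem.IsReduced, cs.wordProd_cons, h, hω.eq]; rfl
      · intro j hj
        rcases List.mem_cons.1 hj with rfl | hj
        · exact hx
        · exact hωJ j hj
    · have ht := cs.isReflection_simple i
      have hr : cs.IsReflection ((cs.wordProd ω)⁻¹ * cs.simple i * cs.wordProd ω) := by
        simpa using ht.conj (cs.wordProd ω)⁻¹
      have hm := mem_of_eta cs ω _ ((eta_iff cs (cs.wordProd ω) _ hr).2 (by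
        rw [← mul_assoc, mul_inv_cancel_left]; omega))
      obtain ⟨j, hj, e⟩ := List.mem_iff_getElem.1 hm
      have h2 := cs.wordProd_mul_getD_rightInvSeq ω j
      rw [List.getD_eq_getElem _ _ hj, e, ← mul_assoc, mul_inv_cancel_left] at h2
      refine ⟨ω.eraseIdx j, ?_, ?_, h2.symm⟩
      · have hl : j < ω.length := by simpa using hj
        have h3 := List.length_eraseIdx_of_lt hl
        rw [CoxeterSystem.IsReduced, ← h2, h3]
        have := hω.eq
        omega
      · intro k hk
        exact hωJ k (List.mem_of_mem_eraseIdx hk)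
  induction hu using Subgroup.closure_induction_left with
  | one => exact ⟨[], by simp [CoxeterSystem.IsReduced], by simp, by simp⟩
  | mul_left x hx y _ ih => exact step x hx y ih
  | inv_mul_cancel x hx y _ ih =>
    have : x⁻¹ = x := by obtain ⟨i, rfl⟩ := hJ hx; simp
    rw [this]; exact step x hx y ih

lemma red_tail (cs : CoxeterSystem M W) {i : B} {ω : List B} (h : cs.IsReduced (i :: ω)) :
    cs.IsReduced ω ∧ cs.length (cs.wordProd ω) < cs.length (cs.simple i * cs.wordProd ω) := by
  have h1 : cs.IsReduced ω := by simpa using h.drop 1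
  refine ⟨h1, ?_⟩
  rw [← cs.wordProd_cons, h.eq, h1.eq]; simp

lemma word_mem (cs : CoxeterSystem M W) (J : Set W) (ω : List B)
    (h : ∀ i ∈ ω, cs.simple i ∈ J) : cs.wordProd ω ∈ Subgroup.closure J := by
  induction ω with
  | nil => simp
  | cons i ω ih =>
    rw [cs.wordProd_cons]
    exact mul_mem (Subgroup.subset_closure (h i (by simp)))
      (ih fun j hj => h j (List.mem_cons_of_mem _ hj))

/-- reflections of `W_J` are not left inversions of `a` -/
def G (cs : CoxeterSystem M W) (J : Set W) (a : W) : Prop :=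
  ∀ t ∈ Subgroup.closure J, cs.IsReflection t → cs.length a < cs.length (t * a)

lemma G_of_min (cs : CoxeterSystem M W) (J : Set W) (a : W) (h : a ∈ cs.minRight J) :
    G cs J a := by
  intro t ht hr
  rw [h t ht]
  have := hr.odd_length.pos
  omega

/-- if `y < s y` in `W_J` then `y a < s y a`. -/
lemma G_up (cs : CoxeterSystem M W) (J : Set W) (a : W) (h : G cs J a) (y : W)
    (hy : y ∈ Subgroup.closure J) (i : B) (hi : cs.simple i ∈ J)
    (hl : cs.length y < cs.length (cs.simple i * y)) :
    cs.length (y * a) < cs.length (cs.simple i * (y * a)) := by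
  have hs := cs.isReflection_simple i
  have r1 : cs.IsReflection (y⁻¹ * cs.simple i * y) := by simpa using hs.conj y⁻¹
  have r2 : cs.IsReflection ((y * a)⁻¹ * cs.simple i * (y * a)) := by simpa using hs.conj (y * a)⁻¹
  have r3 : cs.IsReflection (a⁻¹ * (y⁻¹ * cs.simple i * y) * a) := by simpa using r1.conj a⁻¹
  have e1 := (eta_zero_iff cs y _ r1).2 (by rwa [← mul_assoc, mul_inv_cancel_left])
  have e2 := (eta_zero_iff cs a _ r3).2 (by
    rw [← mul_assoc, mul_inv_cancel_left]
    exact h _ (mul_mem (mul_mem (inv_mem hy) (Subgroup.subset_closure hi)) hy) r1)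
  have := (eta_zero_iff cs (y * a) _ r2).1 (by
    have q1 : (y * a)⁻¹ * cs.simple i * (y * a) = a⁻¹ * (y⁻¹ * cs.simple i * y) * a := by group
    have q2 : a * (a⁻¹ * (y⁻¹ * cs.simple i * y) * a) * a⁻¹ = y⁻¹ * cs.simple i * y := by group
    rw [q1, eta_mul, q2, e1, e2, add_zero])
  rwa [← mul_assoc (y * a), mul_inv_cancel_left] at this

lemma up_one (cs : CoxeterSystem M W) (x : W) (i : B)
    (h : cs.length x < cs.length (cs.simple i * x)) :
    cs.length (cs.simple i * x) = cs.length x + 1 := by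
  rcases cs.length_simple_mul x i with h | h <;> omega

lemma G_add (cs : CoxeterSystem M W) (J : Set W) (a : W) (h : G cs J a) (ω : List B)
    (hω : cs.IsReduced ω) (hJ : ∀ i ∈ ω, cs.simple i ∈ J) :
    cs.length (cs.wordProd ω * a) = cs.length (cs.wordProd ω) + cs.length a := by
  induction ω with
  | nil => simp
  | cons i ω ih =>
    obtain ⟨h1, h2⟩ := red_tail cs hω
    have hJ' : ∀ j ∈ ω, cs.simple j ∈ J := fun j hj => hJ j (List.mem_cons_of_mem _ hj)
    have h3 := G_up cs J a h _ (word_mem cs J ω hJ') i (hJ i (by simp)) h2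
    rw [cs.wordProd_cons, mul_assoc, up_one cs _ _ h2, up_one cs _ _ h3, ih h1 hJ']
    omega

lemma G_min (cs : CoxeterSystem M W) (J : Set W) (hJ : J ⊆ cs.simples) (a : W) (h : G cs J a) :
    a ∈ cs.minRight J := by
  intro u hu
  obtain ⟨ω, h1, h2, rfl⟩ := exists_red cs J hJ u hu
  exact G_add cs J a h ω h1 h2

/-- Deodhar's lemma -/
lemma deodhar (cs : CoxeterSystem M W) (J : Set W) (hJ : J ⊆ cs.simples) (a : W) (h : G cs J a)
    (i : B) : G cs J (a * cs.simple i) ∨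
      ∃ j, cs.simple j ∈ Subgroup.closure J ∧ a * cs.simple i = cs.simple j * a := by
  by_cases hg : G cs J (a * cs.simple i)
  · left; exact hg
  right
  unfold G at hg
  push Not at hg
  obtain ⟨t, ht, hr, hl⟩ := hg
  have r : cs.IsReflection (a⁻¹ * t * a) := by simpa using hr.conj a⁻¹
  have e : a⁻¹ * t * a = cs.simple i := by
    by_contra hne
    have := F1 cs a _ i r hne (by rw [← mul_assoc, mul_inv_cancel_left]; exact h t ht hr)
    rw [← mul_assoc a, mul_inv_cancel_left, mul_assoc t] at this
    omega
  have e' : a * cs.simple i = t * a := by rw [← e]; group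
  have h1 := G_min cs J hJ a h t ht
  have h2 := cs.length_mul_le a (cs.simple i)
  rw [e', cs.length_simple] at h2
  have h3 := hr.odd_length.pos
  obtain ⟨j, rfl⟩ := cs.length_eq_one_iff.1 (show cs.length t = 1 by omega)
  exact ⟨j, ht, e'⟩

lemma mono_a (cs : CoxeterSystem M W) (J : Set W) (a : W) (h : G cs J a) (ω : List B)
    (hω : cs.IsReduced ω) (hJ : ∀ i ∈ ω, cs.simple i ∈ J) :
    ∀ q, cs.bruhatLE q (cs.wordProd ω) → cs.bruhatLE (q * a) (cs.wordProd ω * a) := by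
  induction ω with
  | nil => intro q hq; rw [ble_one cs (x := q) (by simpa using hq)]; simpa using ble_refl cs a
  | cons i ω ih =>
    intro q hq
    obtain ⟨h1, h2⟩ := red_tail cs hω
    have hJ' : ∀ j ∈ ω, cs.simple j ∈ J := fun j hj => hJ j (List.mem_cons_of_mem _ hj)
    have h3 := G_up cs J a h _ (word_mem cs J ω hJ') i (hJ i (by simp)) h2
    rw [cs.wordProd_cons] at hq ⊢
    rw [mul_assoc]
    have hc : cs.bruhatLE (cs.simple i * q) (cs.wordProd ω) ∨ cs.bruhatLE q (cs.wordProd ω) := by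
      rcases liftL cs i hq with h | h
      · left; simpa using h
      · right; simpa using h.1
    rcases hc with hc | hc
    · have := liftL_a cs i (ih h1 hJ' _ hc) h3
      simpa [mul_assoc] using this
    · exact ble_trans cs (ih h1 hJ' _ hc) (ble_simpleL cs h3)

lemma lemA (cs : CoxeterSystem M W) (J : Set W) (hJ : J ⊆ cs.simples) (φ : W ≃* W)
    (hφ : ∀ i, ∃ j, φ (cs.simple i) = cs.simple j) (ω : List B)
    (hω : cs.IsReduced ω) (hωJ : ∀ i ∈ ω, cs.simple i ∈ J) :
    ∀ a p q, G cs J a → p ∈ Subgroup.closure J → cs.bruhatLE q p →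
      ∃ c ∈ Subgroup.closure J, cs.bruhatLE c (cs.wordProd ω) ∧
        cs.bruhatLE (q * a * φ c) (p * a * φ (cs.wordProd ω)) := by
  induction ω with
  | nil =>
    intro a p q ha hp hqp
    refine ⟨1, one_mem _, by simpa using ble_refl cs 1, ?_⟩
    obtain ⟨ω, h1, h2, rfl⟩ := exists_red cs J hJ p hp
    simpa using mono_a cs J a ha ω h1 h2 q hqp
  | cons i ω ih =>
    intro a p q ha hp hqp
    obtain ⟨h1, h2⟩ := red_tail cs hω
    have hJ' : ∀ j ∈ ω, cs.simple j ∈ J := fun j hj => hωJ j (List.mem_cons_of_mem _ hj)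
    have hiJ : cs.simple i ∈ Subgroup.closure J := Subgroup.subset_closure (hωJ i (by simp))
    obtain ⟨k, hk⟩ := hφ i
    simp only [cs.wordProd_cons, map_mul, hk]
    rcases deodhar cs J hJ a ha k with hd | ⟨j, hj, e⟩
    · obtain ⟨c, hc, hcl, h⟩ := ih h1 hJ' _ p q hd hp hqp
      refine ⟨cs.simple i * c, mul_mem hiJ hc, liftL_a cs i hcl h2, ?_⟩
      rw [map_mul, hk]
      simpa only [mul_assoc] using h
    · have e2 : p * a * (cs.simple k * φ (cs.wordProd ω)) =
          p * cs.simple j * a * φ (cs.wordProd ω) := by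
        rw [← mul_assoc, mul_assoc p, e]; simp only [mul_assoc]
      rw [e2]
      rcases lift cs j hqp with hl | hl
      · obtain ⟨c, hc, hcl, h⟩ := ih h1 hJ' a (p * cs.simple j) _ ha (mul_mem hp hj) hl
        refine ⟨cs.simple i * c, mul_mem hiJ hc, liftL_a cs i hcl h2, ?_⟩
        rw [map_mul, hk, ← mul_assoc, mul_assoc q, e]
        simpa only [mul_assoc] using h
      · obtain ⟨c, hc, hcl, h⟩ := ih h1 hJ' a (p * cs.simple j) _ ha (mul_mem hp hj) hl.1
        exact ⟨c, hc, ble_trans cs hcl (ble_simpleL cs h2), h⟩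

lemma lemB (cs : CoxeterSystem M W) (J : Set W) (hJ : J ⊆ cs.simples) (φ : W ≃* W)
    (hφ : ∀ i, ∃ j, φ (cs.simple i) = cs.simple j) (a : W) (ha : G cs J a) (n : ℕ) :
    ∀ p q, cs.length q ≤ n → p ∈ Subgroup.closure J → q ∈ Subgroup.closure J →
      cs.bruhatLE q p →
      ∃ u ∈ Subgroup.closure J, cs.bruhatLE (u * a * (φ u)⁻¹) (p * a * (φ q)⁻¹) := by
  induction n with
  | zero =>
    intro p q hn hp hq hqp
    have : q = 1 := cs.length_eq_zero_iff.1 (by omega)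
    subst this
    obtain ⟨c, hc, hcl, h⟩ := lemA cs J hJ φ hφ [] (by simp [CoxeterSystem.IsReduced]) (by simp)
      a p 1 ha hp hqp
    have := ble_one cs (by simpa using hcl)
    subst this
    exact ⟨1, one_mem _, by simpa using h⟩
  | succ n ih =>
    intro p q hn hp hq hqp
    obtain ⟨ω, h1, h2, h3⟩ := exists_red cs J hJ q⁻¹ (inv_mem hq)
    obtain ⟨c, hc, hcl, h⟩ := lemA cs J hJ φ hφ ω h1 h2 a p q ha hp hqp
    rw [h3, map_inv] at h
    rw [h3] at hcl
    rcases ble_len cs hcl with hc' | hlt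
    · subst hc'
      exact ⟨q, hq, by simpa using h⟩
    · rw [cs.length_inv] at hlt
      obtain ⟨u, hu, h'⟩ := ih q c⁻¹ (by rw [cs.length_inv]; omega) hq (inv_mem hc)
        (by simpa using ble_inv cs hcl)
      refine ⟨u, hu, ble_trans cs h' ?_⟩
      simpa using h

lemma peelR (cs : CoxeterSystem M W) (J : Set W) (φ : W ≃* W)
    (hφ : ∀ i, ∃ j, φ (cs.simple i) = cs.simple j) (ω : List B)
    (hω : cs.IsReduced ω) (hωJ : ∀ i ∈ ω, cs.simple i ∈ J) :
    ∀ g h, cs.bruhatLE g (h * φ (cs.wordProd ω)) →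
      ∃ c ∈ Subgroup.closure J, cs.bruhatLE c (cs.wordProd ω) ∧ cs.bruhatLE (g * (φ c)⁻¹) h := by
  induction ω with
  | nil =>
    intro g h hg
    exact ⟨1, one_mem _, by simpa using ble_refl cs 1, by simpa using hg⟩
  | cons i ω ih =>
    intro g h hg
    obtain ⟨h1, h2⟩ := red_tail cs hω
    have hJ' : ∀ j ∈ ω, cs.simple j ∈ J := fun j hj => hωJ j (List.mem_cons_of_mem _ hj)
    have hiJ : cs.simple i ∈ Subgroup.closure J := Subgroup.subset_closure (hωJ i (by simp))
    obtain ⟨k, hk⟩ := hφ i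
    simp only [cs.wordProd_cons, map_mul, hk] at hg ⊢
    obtain ⟨c, hc, hcl, hh⟩ := ih h1 hJ' g (h * cs.simple k) (by simpa only [mul_assoc] using hg)
    rcases lift cs k hh with hl | hl
    · refine ⟨cs.simple i * c, mul_mem hiJ hc, liftL_a cs i hcl h2, ?_⟩
      simpa [mul_assoc, hk] using hl
    · refine ⟨c, hc, ble_trans cs hcl (ble_simpleL cs h2), ?_⟩
      simpa [mul_assoc] using hl.1

lemma peelL (cs : CoxeterSystem M W) (J : Set W) (b : W) (ω : List B)
    (hω : cs.IsReduced ω) (hωJ : ∀ i ∈ ω, cs.simple i ∈ J) :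
    ∀ g, cs.bruhatLE g (cs.wordProd ω * b) →
      ∃ c ∈ Subgroup.closure J, cs.bruhatLE c (cs.wordProd ω) ∧ cs.bruhatLE (c⁻¹ * g) b := by
  induction ω with
  | nil =>
    intro g hg
    exact ⟨1, one_mem _, by simpa using ble_refl cs 1, by simpa using hg⟩
  | cons i ω ih =>
    intro g hg
    obtain ⟨h1, h2⟩ := red_tail cs hω
    have hJ' : ∀ j ∈ ω, cs.simple j ∈ J := fun j hj => hωJ j (List.mem_cons_of_mem _ hj)
    have hiJ : cs.simple i ∈ Subgroup.closure J := Subgroup.subset_closure (hωJ i (by simp))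
    rw [cs.wordProd_cons, mul_assoc] at hg
    rw [cs.wordProd_cons]
    rcases liftL cs i hg with hl | hl
    · obtain ⟨c, hc, hcl, hh⟩ := ih h1 hJ' _ (by simpa using hl)
      refine ⟨cs.simple i * c, mul_mem hiJ hc, liftL_a cs i hcl h2, ?_⟩
      simpa [mul_assoc] using hh
    · obtain ⟨c, hc, hcl, hh⟩ := ih h1 hJ' g (by simpa using hl.1)
      exact ⟨c, hc, ble_trans cs hcl (ble_simpleL cs h2), hh⟩

/-- longest elements -/
lemma long_rev (cs : CoxeterSystem M W) (J : Set W) (m : W)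
    (hm : m ∈ Subgroup.closure J) (hmax : ∀ u ∈ Subgroup.closure J, cs.length u ≤ cs.length m)
    (y t : W) (hy : y ∈ Subgroup.closure J) (htJ : t ∈ Subgroup.closure J)
    (ht : cs.IsReflection t) (h : cs.length y < cs.length (y * t)) :
    cs.length (m * y * t) < cs.length (m * y) := by
  have r := ht.conj y
  have e : eta cs m (y * t * y⁻¹) = 1 := by
    rw [eta_iff cs _ _ r]
    have h1 := hmax (m * (y * t * y⁻¹)) (mul_mem hm (mul_mem (mul_mem hy htJ) (inv_mem hy)))
    have h2 := r.length_mul_left_ne m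
    omega
  rw [← eta_iff cs _ _ ht, eta_mul, e, (eta_zero_iff cs y t ht).2 h, zero_add]

lemma red_concat (cs : CoxeterSystem M W) {i : B} {ω : List B} (h : cs.IsReduced (ω ++ [i])) :
    cs.IsReduced ω ∧ cs.length (cs.wordProd ω * cs.simple i) = cs.length (cs.wordProd ω) + 1 := by
  have h1 : cs.IsReduced ω := by simpa using h.take ω.length
  refine ⟨h1, ?_⟩
  have := h.eq
  rw [cs.wordProd_append, cs.wordProd_singleton] at this
  rw [this, h1.eq]; simp

lemma long_word (cs : CoxeterSystem M W) (J : Set W) (m : W)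
    (hm : m ∈ Subgroup.closure J) (hmax : ∀ u ∈ Subgroup.closure J, cs.length u ≤ cs.length m)
    (ω : List B) (hω : cs.IsReduced ω) (hωJ : ∀ i ∈ ω, cs.simple i ∈ J) :
    cs.length (m * cs.wordProd ω) + cs.length (cs.wordProd ω) = cs.length m ∧
    ∀ y, cs.bruhatLE y (cs.wordProd ω) → cs.bruhatLE (m * cs.wordProd ω) (m * y) := by
  induction ω using List.reverseRecOn with
  | nil =>
    refine ⟨by simp, fun y hy => ?_⟩
    rw [ble_one cs (x := y) (by simpa using hy)]; simpa using ble_refl cs m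
  | append_singleton ω i ih =>
    obtain ⟨h1, h2⟩ := red_concat cs hω
    have hJ' : ∀ j ∈ ω, cs.simple j ∈ J := fun j hj => hωJ j (by simp [hj])
    have hiJ : cs.simple i ∈ Subgroup.closure J := Subgroup.subset_closure (hωJ i (by simp))
    obtain ⟨e, hb⟩ := ih h1 hJ'
    have hlt := long_rev cs J m hm hmax (cs.wordProd ω) (cs.simple i) (word_mem cs J ω hJ') hiJ
      (cs.isReflection_simple i) (by omega)
    rw [cs.wordProd_append, cs.wordProd_singleton, ← mul_assoc]
    constructor
    · rcases cs.length_mul_simple (m * cs.wordProd ω) i with h | h <;> omega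
    · intro y hy
      rcases lift cs i hy with hl | hl
      · have := lift_b cs i (hb _ (by simpa [mul_assoc] using hl)) hlt
        simpa [mul_assoc] using this
      · refine ble_trans cs ?_ (hb y (by simpa [mul_assoc] using hl.1))
        have := ble_simple cs (x := m * cs.wordProd ω * cs.simple i) (i := i)
          (by simpa [mul_assoc] using hlt)
        simpa [mul_assoc] using this

lemma long_len (cs : CoxeterSystem M W) (J : Set W) (hJ : J ⊆ cs.simples) (m : W)
    (hm : m ∈ Subgroup.closure J) (hmax : ∀ u ∈ Subgroup.closure J, cs.length u ≤ cs.length m)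
    (y : W) (hy : y ∈ Subgroup.closure J) :
    cs.length (m * y) + cs.length y = cs.length m := by
  obtain ⟨ω, h1, h2, rfl⟩ := exists_red cs J hJ y hy
  exact (long_word cs J m hm hmax ω h1 h2).1

lemma long_ble (cs : CoxeterSystem M W) (J : Set W) (hJ : J ⊆ cs.simples) (m : W)
    (hm : m ∈ Subgroup.closure J) (hmax : ∀ u ∈ Subgroup.closure J, cs.length u ≤ cs.length m)
    (x y : W) (hy : y ∈ Subgroup.closure J) (hxy : cs.bruhatLE x y) :
    cs.bruhatLE (m * y) (m * x) := by
  obtain ⟨ω, h1, h2, rfl⟩ := exists_red cs J hJ y hy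
  exact (long_word cs J m hm hmax ω h1 h2).2 x hxy

lemma long_sq (cs : CoxeterSystem M W) (J : Set W) (hJ : J ⊆ cs.simples) (m : W)
    (hm : m ∈ Subgroup.closure J) (hmax : ∀ u ∈ Subgroup.closure J, cs.length u ≤ cs.length m) :
    m * m = 1 := by
  have := long_len cs J hJ m hm hmax m hm
  exact cs.length_eq_zero_iff.1 (by omega)

lemma long_len' (cs : CoxeterSystem M W) (J : Set W) (hJ : J ⊆ cs.simples) (m : W)
    (hm : m ∈ Subgroup.closure J) (hmax : ∀ u ∈ Subgroup.closure J, cs.length u ≤ cs.length m)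
    (y : W) (hy : y ∈ Subgroup.closure J) :
    cs.length (y * m) + cs.length y = cs.length m := by
  have h := long_len cs J hJ m hm hmax y⁻¹ (inv_mem hy)
  have e : m⁻¹ = m := inv_eq_of_mul_eq_one_left (long_sq cs J hJ m hm hmax)
  rw [← cs.length_inv (y * m), mul_inv_rev, e]
  rwa [cs.length_inv y] at h

lemma closure_simples (cs : CoxeterSystem M W) (w : W) : w ∈ Subgroup.closure cs.simples := by
  obtain ⟨ω, -, rfl⟩ := cs.exists_isReduced w
  exact word_mem cs _ ω fun i _ => ⟨i, rfl⟩

end CoxAux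

/-- The bijection `σ0 : ^IW → ^JW`, `w ↦ w0^I · w`, reverses the twisted order relations
`⪯_I` and `⪯_J` defined via a length-preserving automorphism `φ` of `(W, S)` and
`z = φ(w0^I)`. -/
theorem sigma0_order_reversing [Finite W] (cs : CoxeterSystem M W)
    (I : Set W) (hI : I ⊆ cs.simples)
    (w0 : W) (hw0 : ∀ w : W, cs.length w ≤ cs.length w0)
    (J : Set W) (hJ : J = (fun s => w0 * s * w0) '' I)
    (wI0 : W) (hwI0mem : wI0 ∈ Subgroup.closure I)
    (hwI0max : ∀ u ∈ Subgroup.closure I, cs.length u ≤ cs.length wI0)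
    (φ : W ≃* W) (hφ : (φ : W → W) '' cs.simples = cs.simples)
    (z : W) (hz : z = φ (w0 * wI0)) :
    Set.BijOn (fun w : W => (w0 * wI0) * w) (cs.minRight I) (cs.minRight J) ∧
    (∀ w ∈ cs.minRight I, ∀ w' ∈ cs.minRight I,
      (∃ u ∈ Subgroup.closure I, cs.bruhatLE (u * w' * z * (φ u)⁻¹ * z⁻¹) w) →
      (∃ u ∈ Subgroup.closure J,
        cs.bruhatLE (u * ((w0 * wI0) * w) * (φ u)⁻¹) ((w0 * wI0) * w'))) := by
  have hS : cs.simples ⊆ cs.simples := subset_rfl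
  have hall := CoxAux.closure_simples cs
  have hw0' : ∀ u ∈ Subgroup.closure cs.simples, cs.length u ≤ cs.length w0 := fun u _ => hw0 u
  have L : ∀ y, cs.length (w0 * y) + cs.length y = cs.length w0 := fun y =>
    CoxAux.long_len cs _ hS w0 (hall _) hw0' y (hall _)
  have L' : ∀ y, cs.length (y * w0) + cs.length y = cs.length w0 := fun y =>
    CoxAux.long_len' cs _ hS w0 (hall _) hw0' y (hall _)
  have w2 : w0 * w0 = 1 := CoxAux.long_sq cs _ hS w0 (hall _) hw0'
  have c2 : ∀ y, w0 * (w0 * y) = y := fun y => by rw [← mul_assoc, w2, one_mul]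
  have wi : w0⁻¹ = w0 := inv_eq_of_mul_eq_one_left w2
  have m2 : wI0 * wI0 = 1 := CoxAux.long_sq cs I hI wI0 hwI0mem hwI0max
  have d2 : ∀ y, wI0 * (wI0 * y) = y := fun y => by rw [← mul_assoc, m2, one_mul]
  have mi : wI0⁻¹ = wI0 := inv_eq_of_mul_eq_one_left m2
  have LI := CoxAux.long_len' cs I hI wI0 hwI0mem hwI0max
  have conjlen : ∀ y, cs.length (w0 * y * w0) = cs.length y := by
    intro y
    have h1 := L (y * w0)
    have h2 := L' y
    rw [mul_assoc]; omega
  have hJS : J ⊆ cs.simples := by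
    rw [hJ]
    rintro _ ⟨s, hs, rfl⟩
    obtain ⟨i, rfl⟩ := hI hs
    obtain ⟨j, hj⟩ := cs.length_eq_one_iff.1
      (show cs.length (w0 * cs.simple i * w0) = 1 by rw [conjlen, cs.length_simple])
    exact ⟨j, hj.symm⟩
  have hcl : Subgroup.closure J = (Subgroup.closure I).map (MulAut.conj w0).toMonoidHom := by
    rw [MonoidHom.map_closure, hJ]
    congr 1
    ext s
    simp [wi]
  have toJ : ∀ u ∈ Subgroup.closure I, w0 * u * w0 ∈ Subgroup.closure J := by
    intro u hu
    rw [hcl]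
    exact ⟨u, hu, by simp [wi]⟩
  have fromJ : ∀ v ∈ Subgroup.closure J, ∃ u ∈ Subgroup.closure I, v = w0 * u * w0 := by
    intro v hv
    rw [hcl] at hv
    obtain ⟨u, hu, rfl⟩ := hv
    exact ⟨u, hu, by simp [wi]⟩
  have maps : ∀ w ∈ cs.minRight I, w0 * wI0 * w ∈ cs.minRight J := by
    intro w hw v hv
    obtain ⟨u, hu, rfl⟩ := fromJ v hv
    have e : w0 * u * w0 * (w0 * wI0 * w) = w0 * (u * wI0 * w) := by simp [mul_assoc, c2]
    have h1 := hw (u * wI0) (mul_mem hu hwI0mem)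
    have h2 := hw wI0 hwI0mem
    have h3 := L (u * wI0 * w)
    have h4 := L (wI0 * w)
    have h5 := LI u hu
    rw [e, conjlen, mul_assoc w0 wI0]
    omega
  refine ⟨⟨maps, fun x _ y _ h => mul_left_cancel h, ?_⟩, ?_⟩
  · intro y hy
    refine ⟨wI0 * w0 * y, ?_, by simp [mul_assoc, d2, c2]⟩
    have key : ∀ u ∈ Subgroup.closure I,
        cs.length (u * (w0 * y)) + cs.length u + cs.length y = cs.length w0 := by
      intro u hu
      have e : u * (w0 * y) = w0 * (w0 * u * w0 * y) := by simp [mul_assoc, c2]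
      have h1 := hy _ (toJ u hu)
      have h2 := L (w0 * u * w0 * y)
      rw [conjlen] at h1
      rw [e]; omega
    intro u hu
    have h1 := key (u * wI0) (mul_mem hu hwI0mem)
    have h2 := key wI0 hwI0mem
    have h3 := LI u hu
    have e : u * (wI0 * w0 * y) = u * wI0 * (w0 * y) := by simp [mul_assoc]
    rw [e, mul_assoc wI0]
    omega
  · rintro w hw w' hw' ⟨u, hu, hle⟩
    have hφ' : ∀ i, ∃ j, φ (cs.simple i) = cs.simple j := by
      intro i
      have : φ (cs.simple i) ∈ cs.simples := by rw [← hφ]; exact ⟨_, ⟨i, rfl⟩, rfl⟩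
      obtain ⟨j, hj⟩ := this
      exact ⟨j, hj.symm⟩
    obtain ⟨m, hm⟩ : ∃ m, m = w0 * wI0 * w0 := ⟨_, rfl⟩
    obtain ⟨v, hv⟩ : ∃ v, v = w0 * (wI0 * u * wI0) * w0 := ⟨_, rfl⟩
    have hmJ : m ∈ Subgroup.closure J := hm ▸ toJ _ hwI0mem
    have hvJ : v ∈ Subgroup.closure J :=
      hv ▸ toJ _ (mul_mem (mul_mem hwI0mem hu) hwI0mem)
    have hmmax : ∀ y ∈ Subgroup.closure J, cs.length y ≤ cs.length m := by
      intro y hy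
      obtain ⟨u, hu, rfl⟩ := fromJ y hy
      rw [hm, conjlen, conjlen]; exact hwI0max u hu
    have mm := CoxAux.long_sq cs J hJS m hmJ hmmax
    have ha := CoxAux.G_of_min cs J _ (maps w hw)
    have e1 : u * w' * z * (φ u)⁻¹ * z⁻¹ = u * w' * φ v⁻¹ := by
      have : v⁻¹ = (w0 * wI0) * u⁻¹ * (w0 * wI0)⁻¹ := by
        rw [hv]; simp [mul_assoc, wi, mi]
      rw [this, hz]
      simp only [map_mul, map_inv, mul_inv_rev, mul_assoc]
    rw [e1] at hle
    have h1 := CoxAux.long_ble cs _ hS w0 (hall _) hw0' _ _ (hall _) hle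
    have e2 : w0 * w = m * (w0 * wI0 * w) := by rw [hm]; simp [mul_assoc, c2, d2]
    have e3 : w0 * (u * w' * φ v⁻¹) = m * v * (w0 * wI0 * w') * φ v⁻¹ := by
      rw [hm, hv]; simp [mul_assoc, c2, d2]
    rw [e2, e3] at h1
    obtain ⟨ω, r1, r2, r3⟩ := CoxAux.exists_red cs J hJS v⁻¹ (inv_mem hvJ)
    rw [← r3] at h1
    obtain ⟨c, hc, hcl', h2⟩ := CoxAux.peelR cs J φ hφ' ω r1 r2 _ _ h1
    rw [r3] at hcl'
    obtain ⟨ω', s1, s2, s3⟩ := CoxAux.exists_red cs J hJS (m * v) (mul_mem hmJ hvJ)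
    rw [← s3] at h2
    obtain ⟨y, hy, hyl, h3⟩ := CoxAux.peelL cs J _ ω' s1 s2 _ h2
    rw [s3] at hyl
    have h4 := CoxAux.long_ble cs J hJS m hmJ hmmax _ _ (mul_mem hmJ hvJ) hyl
    rw [← mul_assoc, mm, one_mul] at h4
    have h5 := CoxAux.ble_trans cs hcl' (CoxAux.ble_inv cs h4)
    obtain ⟨x, hx, h6⟩ := CoxAux.lemB cs J hJS φ hφ' _ ha _ _ c le_rfl
      (inv_mem (mul_mem hmJ hy)) hc h5
    refine ⟨x, hx, CoxAux.ble_trans cs h6 ?_⟩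
    have mi' : m⁻¹ = m := inv_eq_of_mul_eq_one_left mm
    rw [mul_inv_rev, mi']
    simpa only [mul_assoc] using h3
end

section
/- Let p be a prime with p ≥ 3, let R be a commutative ring and let π ∈ R be an element such that π^(p−1) ∈ p·R. Set ω := p·1_R − π. Then for every natural number n one has ω^(p^n) ∈ p^((p^n − 1)/(p − 1)) · ω · R, where (p^n − 1)/(p − 1) = 1 + p + ⋯ + p^(n−1). -/
/-- Let `p ≥ 3` be prime, `R` a commutative ring and `π ∈ R` with `π^(p−1) ∈ p·R`. Then,
setting `ω := p − π`, for every `n` one has `ω^(p^n) ∈ p^((p^n − 1)/(p − 1)) · ω · R`, where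
`(p^n − 1)/(p − 1) = 1 + p + ⋯ + p^(n−1)`. -/
theorem omega_pow_divisibility (p : ℕ) (hp : p.Prime) (hp3 : 3 ≤ p)
    (R : Type*) [CommRing R] (π : R) (hπ : (p : R) ∣ π ^ (p - 1))
    (ω : R) (hω : ω = (p : R) - π) (n : ℕ) :
    (p : R) ^ ((p ^ n - 1) / (p - 1)) * ω ∣ ω ^ (p ^ n) := by
  have h1 : (p : R) ∣ ω ^ (p - 1) := by
    have h2 : (p : R) ∣ ω ^ (p - 1) - (-π) ^ (p - 1) :=
      dvd_trans ⟨1, by rw [hω]; ring⟩ (sub_dvd_pow_sub_pow ω (-π) (p - 1))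
    have h3 : (p : R) ∣ (-π) ^ (p - 1) := by
      rw [neg_pow]
      exact Dvd.dvd.mul_left hπ _
    exact (dvd_iff_dvd_of_dvd_sub h2).mpr h3
  have h4 : p - 1 ∣ p ^ n - 1 := by
    simpa using Nat.sub_dvd_pow_sub_pow p 1 n
  have h5 : p ^ n = (p - 1) * ((p ^ n - 1) / (p - 1)) + 1 := by
    rw [Nat.mul_div_cancel' h4]
    have : 0 < p ^ n := pow_pos hp.pos n
    omega
  have h6 : ω ^ (p ^ n) = (ω ^ (p - 1)) ^ ((p ^ n - 1) / (p - 1)) * ω := by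
    rw [← pow_mul, ← pow_succ, ← h5]
  rw [h6]
  exact mul_dvd_mul_right (pow_dvd_pow_of_dvd h1 _) ω
end
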